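/- arXiv:1109.0342 — 2 statements merged into one kernel-verified Lean document; each statement's English description precedes it below -/
import Mathlib

section
/- Let f ≥ 2 and n = 2f. Then in A one has Ĥ₂^{{1,2,3,4}} · D̂_{(3,2f−4)}^{{2,…,2f}} = D̂_{(1,2,2f−4)}^{{2,…,2f}}, where the hats denote Ŝ = Σ_{w∈S} q^{ℓ(w)} T_w for the respective subsets S of S_{2f}. -/
open Finset
open scoped Pointwise

namespace BMWPaper

/-- The Coxeter length of a permutation of `Fin n`: the number of inversions. -/
def len {n : ℕ} (w : Equiv.Perm (Fin n)) : ℕ :=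
  (Finset.univ.filter (fun p : Fin n × Fin n => p.1 < p.2 ∧ w p.2 < w p.1)).card

/-- `sGen n i` is the adjacent transposition `s_i = (i, i+1)` (1-based) in `S_n`;
it is the identity for out-of-range `i`. -/
def sGen (n i : ℕ) : Equiv.Perm (Fin n) :=
  if h : 1 ≤ i ∧ i < n then Equiv.swap ⟨i - 1, by omega⟩ ⟨i, h.2⟩ else 1

/-- `pimg d i` is the (1-based) image `(i)d` of the point `i ∈ {1,…,n}` under the
*right* action of the permutation `d` (permutations act on points on the right,
so that `(a)(στ) = ((a)σ)τ` for the group multiplication `σ * τ`);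
the junk value `0` is returned for out-of-range `i`. -/
def pimg {n : ℕ} (d : Equiv.Perm (Fin n)) (i : ℕ) : ℕ :=
  if h : i - 1 < n then ((d⁻¹ ⟨i - 1, h⟩ : Fin n) : ℕ) + 1 else 0

open scoped Classical in
/-- `Hset n f` is the set `H_f(n)` of all `d ∈ S_n` such that
`(1)d < (3)d < ⋯ < (2f-1)d`, `(2i-1)d < (2i)d` for `i = 1,…,f`, and
`(2f+1)d < (2f+2)d < ⋯ < (n)d`. -/
noncomputable def Hset (n f : ℕ) : Finset (Equiv.Perm (Fin n)) :=
  Finset.univ.filter (fun d =>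
    (∀ i ∈ Finset.Icc 1 (f - 1), pimg d (2 * i - 1) < pimg d (2 * i + 1)) ∧
    (∀ i ∈ Finset.Icc 1 f, pimg d (2 * i - 1) < pimg d (2 * i)) ∧
    (∀ j ∈ Finset.Icc (2 * f + 1) (n - 1), pimg d j < pimg d (j + 1)))

/-- The index of the block of the composition `μ` containing the (0-based) point `k`. -/
def blockOf (μ : List ℕ) (k : ℕ) : ℕ :=
  ((List.range μ.length).filter (fun j => (μ.take (j + 1)).sum ≤ k)).length

open scoped Classical in
/-- The Young subgroup `S_μ` of `S_n` associated with a composition `μ` of `n`,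
as the set of permutations preserving each of the consecutive blocks of `μ`. -/
noncomputable def youngSet (n : ℕ) (μ : List ℕ) : Finset (Equiv.Perm (Fin n)) :=
  Finset.univ.filter (fun w => ∀ a : Fin n, blockOf μ ((w a : ℕ)) = blockOf μ (a : ℕ))

open scoped Classical in
/-- The set `D_μ` of minimal-length right coset representatives of `S_μ` in `S_n`:
the elements of minimal length in their right coset `S_μ d`. -/
noncomputable def Dset (n : ℕ) (μ : List ℕ) : Finset (Equiv.Perm (Fin n)) :=
  Finset.univ.filter (fun d => ∀ u ∈ youngSet n μ, len d ≤ len (u * d))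

/-- The identification of `Fin m` with the block `[k, k+m)` of `Fin n` (0-based). -/
def shiftEquiv (n k m : ℕ) (h : k + m ≤ n) :
    Fin m ≃ {a : Fin n // k ≤ (a : ℕ) ∧ (a : ℕ) < k + m} where
  toFun b := ⟨⟨k + (b : ℕ), by have := b.isLt; omega⟩, by
    constructor
    · exact Nat.le_add_right _ _
    · have := b.isLt; simp only [Fin.val_mk]; omega⟩
  invFun a := ⟨(a : Fin n) - k, by have := a.2; omega⟩
  left_inv b := by
    apply Fin.ext
    simp
  right_inv a := by
    apply Subtype.ext
    apply Fin.ext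
    have := a.2
    simp only []
    omega

open scoped Classical in
/-- The embedding of `S_m` into `S_n` as the group of permutations of the
(1-based) block `{k+1, …, k+m}` of `{1, …, n}`. -/
noncomputable def shiftEmb (n k m : ℕ) (w : Equiv.Perm (Fin m)) : Equiv.Perm (Fin n) :=
  if h : k + m ≤ n then w.extendDomain (shiftEquiv n k m h) else 1

open scoped Classical in
/-- The subgroup of `S_n` of permutations fixing the (1-based) points `1, …, k`. -/
noncomputable def fixSet (n k : ℕ) : Finset (Equiv.Perm (Fin n)) :=
  Finset.univ.filter (fun w => ∀ a : Fin n, (a : ℕ) < k → w a = a)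


/-- `bbs n i` is the permutation `𝕤_i = s_{2i} s_{2i-1} s_{2i+1} s_{2i} = (2i-1, 2i+1)(2i, 2i+2)`. -/
def bbs (n i : ℕ) : Equiv.Perm (Fin n) :=
  sGen n (2 * i) * sGen n (2 * i - 1) * sGen n (2 * i + 1) * sGen n (2 * i)

open scoped Classical in
/-- The set `𝔻_{(1,f-1)} = {𝕤_1 𝕤_2 ⋯ 𝕤_k : k = 0, …, f-1}` in `S_{2f}`. -/
noncomputable def bbD1 (f : ℕ) : Finset (Equiv.Perm (Fin (2 * f))) :=
  (Finset.range f).image (fun k => ((List.range k).map (fun j => bbs (2 * f) (j + 1))).prod)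

open scoped Classical in
/-- The set `𝔻_{(1,f-2)}^{{2,…,f}} = {𝕤_2 𝕤_3 ⋯ 𝕤_k : k = 1, …, f-1}` in `S_{2f}`. -/
noncomputable def bbD1' (f : ℕ) : Finset (Equiv.Perm (Fin (2 * f))) :=
  (Finset.Icc 1 (f - 1)).image
    (fun k => ((List.range (k - 1)).map (fun j => bbs (2 * f) (j + 2))).prod)

open scoped Classical in
/-- `H_f^{(a)} = {d ∈ H_f(n) : (1)d⁻¹ = 1, (2)d⁻¹ = 2}`. -/
noncomputable def HsetA (n f : ℕ) : Finset (Equiv.Perm (Fin n)) :=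
  (Hset n f).filter (fun d => pimg d⁻¹ 1 = 1 ∧ pimg d⁻¹ 2 = 2)

open scoped Classical in
/-- `H_f^{(b)} = {d ∈ H_f(n) : (1)d⁻¹ = 1, (2)d⁻¹ = 3}`. -/
noncomputable def HsetB (n f : ℕ) : Finset (Equiv.Perm (Fin n)) :=
  (Hset n f).filter (fun d => pimg d⁻¹ 1 = 1 ∧ pimg d⁻¹ 2 = 3)

open scoped Classical in
/-- `H_f^{(c)} = {d ∈ H_f(n) : (1)d⁻¹ = 1, (2)d⁻¹ = 2f+1}`. -/
noncomputable def HsetC (n f : ℕ) : Finset (Equiv.Perm (Fin n)) :=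
  (Hset n f).filter (fun d => pimg d⁻¹ 1 = 1 ∧ pimg d⁻¹ 2 = 2 * f + 1)

open scoped Classical in
/-- `H_f^{(d)} = {d ∈ H_f(n) : (1)d⁻¹ = 2f+1, (2)d⁻¹ = 1}`. -/
noncomputable def HsetD (n f : ℕ) : Finset (Equiv.Perm (Fin n)) :=
  (Hset n f).filter (fun d => pimg d⁻¹ 1 = 2 * f + 1 ∧ pimg d⁻¹ 2 = 1)

open scoped Classical in
/-- `H_f^{(e)} = {d ∈ H_f(n) : (1)d⁻¹ = 2f+1, (2)d⁻¹ = 2f+2}`. -/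
noncomputable def HsetE (n f : ℕ) : Finset (Equiv.Perm (Fin n)) :=
  (Hset n f).filter (fun d => pimg d⁻¹ 1 = 2 * f + 1 ∧ pimg d⁻¹ 2 = 2 * f + 2)

section Algebra

variable {F : Type*} [Field F] {A : Type*} [Ring A] [Algebra F A]

/-- For a set `S` of permutations, `hat c Tw S = Σ_{w ∈ S} c^{ℓ(w)} T_w`. -/
noncomputable def hat {n : ℕ} (c : F) (Tw : Equiv.Perm (Fin n) → A)
    (S : Finset (Equiv.Perm (Fin n))) : A :=
  ∑ w ∈ S, c ^ len w • Tw w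

/-- `Ehat E f = E_1 E_3 ⋯ E_{2f-1}`. -/
def Ehat (E : ℕ → A) (f : ℕ) : A := ((List.range f).map (fun i => E (2 * i + 1))).prod

/-- `Tprod T a b = T_a T_{a+1} ⋯ T_b` (the empty product `1` if `b < a`). -/
def Tprod (T : ℕ → A) (a b : ℕ) : A := ((List.range (b + 1 - a)).map (fun t => T (a + t))).prod

/-- `sDesc n a b = s_a s_{a-1} ⋯ s_b` (descending product of adjacent transpositions). -/
def sDesc (n a b : ℕ) : Equiv.Perm (Fin n) :=
  ((List.range (a + 1 - b)).map (fun j => sGen n (a - j))).prod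

/-- The data of a Birman–Murakami–Wenzl algebra structure: an `F`-algebra `A`
with invertible elements `T_1, …, T_{n-1}` and elements `E_1, …, E_{n-1}`
satisfying the BMW relations, together with a map `w ↦ T_w` from `S_n` to `A`
with `T_id = 1`, `T_{s_i} = T_i` and `T_{uv} = T_u T_v` whenever lengths add. -/
structure BMWData (F : Type*) [Field F] (A : Type*) [Ring A] [Algebra F A]
    (n : ℕ) (q r : F) where
  T : ℕ → A
  Tinv : ℕ → A
  E : ℕ → A
  Tw : Equiv.Perm (Fin n) → A
  hq : q ≠ 0
  hr : r ≠ 0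
  hqq : q - q⁻¹ ≠ 0
  T_mul_Tinv : ∀ i, 1 ≤ i → i ≤ n - 1 → T i * Tinv i = 1
  Tinv_mul_T : ∀ i, 1 ≤ i → i ≤ n - 1 → Tinv i * T i = 1
  skein : ∀ i, 1 ≤ i → i ≤ n - 1 → T i - Tinv i = (q - q⁻¹) • (1 - E i)
  Esq : ∀ i, 1 ≤ i → i ≤ n - 1 → E i * E i = (1 + (r - r⁻¹) / (q - q⁻¹)) • E i
  braid : ∀ i, 1 ≤ i → i + 1 ≤ n - 1 → T i * T (i + 1) * T i = T (i + 1) * T i * T (i + 1)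
  T_comm : ∀ i j, 1 ≤ i → i ≤ n - 1 → 1 ≤ j → j ≤ n - 1 → (i + 1 < j ∨ j + 1 < i) →
    T i * T j = T j * T i
  EEE₁ : ∀ i, 1 ≤ i → i + 1 ≤ n - 1 → E i * E (i + 1) * E i = E i
  EEE₂ : ∀ i, 1 ≤ i → i + 1 ≤ n - 1 → E (i + 1) * E i * E (i + 1) = E (i + 1)
  TTE₁ : ∀ i, 1 ≤ i → i + 1 ≤ n - 1 → T i * T (i + 1) * E i = E (i + 1) * E i
  TTE₂ : ∀ i, 1 ≤ i → i + 1 ≤ n - 1 → T (i + 1) * T i * E (i + 1) = E i * E (i + 1)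
  ET : ∀ i, 1 ≤ i → i ≤ n - 1 → E i * T i = r⁻¹ • E i
  TE : ∀ i, 1 ≤ i → i ≤ n - 1 → T i * E i = r⁻¹ • E i
  ETE₁ : ∀ i, 1 ≤ i → i + 1 ≤ n - 1 → E i * T (i + 1) * E i = r • E i
  ETE₂ : ∀ i, 1 ≤ i → i + 1 ≤ n - 1 → E (i + 1) * T i * E (i + 1) = r • E (i + 1)
  Tw_one : Tw 1 = 1
  Tw_s : ∀ i, 1 ≤ i → i ≤ n - 1 → Tw (sGen n i) = T i
  Tw_mul : ∀ u v : Equiv.Perm (Fin n), len (u * v) = len u + len v →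
    Tw (u * v) = Tw u * Tw v

/-- The scalars `a_f` defined by `a_0 = 1` and `a_i = a_{i-1} · Σ_{k=0}^{i-1} q^{2k}`. -/
noncomputable def aseq (q : F) : ℕ → F
  | 0 => 1
  | (i + 1) => aseq q i * (∑ k ∈ Finset.range (i + 1), q ^ (2 * k))


/-- The scalars `c_f` defined by `c_0 = 1` and
`c_f = -((q^{4f-3} - q^{2f-3})/(r q^{2n-2f-2} - q⁻¹)) · c_{f-1}`. -/
noncomputable def cseq (q r : F) (n : ℕ) : ℕ → F
  | 0 => 1
  | (f + 1) =>
      -((q ^ (4 * ((f : ℤ) + 1) - 3) - q ^ (2 * ((f : ℤ) + 1) - 3)) /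
          (r * q ^ (2 * (n : ℤ) - 2 * ((f : ℤ) + 1) - 2) - q⁻¹)) * cseq q r n f

/-- The scalars `č_f` defined by `č_0 = 1` and
`č_f = (q^{3-4f}(1 - q^{2f})/(q + r q^{2+2f-2n})) · č_{f-1}` (with integer exponents). -/
noncomputable def ccseq (q r : F) (n : ℕ) : ℕ → F
  | 0 => 1
  | (f + 1) =>
      (q ^ ((3 : ℤ) - 4 * ((f : ℤ) + 1)) * (1 - q ^ (2 * (f + 1))) /
          (q + r * q ^ ((2 : ℤ) + 2 * ((f : ℤ) + 1) - 2 * (n : ℤ)))) * ccseq q r n f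

/-- The element `x_f = (H_f⁻¹)^ · Ŝ_{{2f+1,…,n}} · Ê_f · Ĥ_f` of the BMW algebra. -/
noncomputable def xEl {F : Type*} [Field F] {A : Type*} [Ring A] [Algebra F A]
    {n : ℕ} {q r : F} (D : BMWData F A n q r) (f : ℕ) : A :=
  hat q D.Tw ((Hset n f).image (fun d => d⁻¹)) * hat q D.Tw (fixSet n (2 * f)) *
    Ehat D.E f * hat q D.Tw (Hset n f)

/-- The element `x̌_f = (H_f⁻¹)ˇ · Š_{{2f+1,…,n}} · Ê_f · Ȟ_f` of the BMW algebra,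
where `ˇ` is formed with `-q⁻¹` in place of `q`. -/
noncomputable def xElCheck {F : Type*} [Field F] {A : Type*} [Ring A] [Algebra F A]
    {n : ℕ} {q r : F} (D : BMWData F A n q r) (f : ℕ) : A :=
  hat (-q⁻¹) D.Tw ((Hset n f).image (fun d => d⁻¹)) * hat (-q⁻¹) D.Tw (fixSet n (2 * f)) *
    Ehat D.E f * hat (-q⁻¹) D.Tw (Hset n f)

end Algebra


/-- Lengths add in `e * v` when `e` does not undo any inversion of `v`. -/
theorem len_mul_of_forall_lt {n : ℕ} (e v : Equiv.Perm (Fin n))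
    (h : ∀ p q, p < q → v q < v p → e (v q) < e (v p)) :
    len (e * v) = len e + len v := by
  unfold len
  rw [← Finset.card_filter_add_card_filter_not (fun p : Fin n × Fin n => v p.2 < v p.1), add_comm]
  congr 1
  · refine Finset.card_bij' (fun p _ => (v p.1, v p.2)) (fun p _ => (v⁻¹ p.1, v⁻¹ p.2)) ?_ ?_ ?_ ?_
    · rintro ⟨p, q⟩ hp
      simp only [Finset.mem_filter, Finset.mem_univ, true_and, not_lt] at hp ⊢
      simp only [Equiv.Perm.mul_apply] at hp
      exact ⟨lt_of_le_of_ne hp.2 fun heq => hp.1.1.ne (v.injective heq), hp.1.2⟩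
    · rintro ⟨a, c⟩ hp
      simp only [Finset.mem_filter, Finset.mem_univ, true_and, not_lt] at hp ⊢
      simp only [Equiv.Perm.mul_apply, Equiv.Perm.coe_inv, Equiv.apply_symm_apply]
      refine ⟨⟨lt_of_not_ge fun hge => ?_, hp.2⟩, hp.1.le⟩
      have hlt : v⁻¹ c < v⁻¹ a :=
        lt_of_le_of_ne hge fun heq => hp.1.ne' (v⁻¹.injective heq)
      have := h _ _ hlt (by simpa using hp.1)
      simp only [Equiv.Perm.coe_inv, Equiv.apply_symm_apply] at this
      exact lt_asymm this hp.2
    · rintro ⟨p, q⟩ _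
      simp
    · rintro ⟨p, q⟩ _
      simp
  · congr 1
    ext ⟨p, q⟩
    simp only [Finset.mem_filter, Finset.mem_univ, true_and]
    exact ⟨fun hp => ⟨hp.1.1, hp.2⟩, fun hp => ⟨⟨hp.1, h p q hp.1 hp.2⟩, hp.2⟩⟩

theorem blockOf_mono (μ : List ℕ) : Monotone (blockOf μ) := by
  intro a b hab
  unfold blockOf
  rw [← List.countP_eq_length_filter, ← List.countP_eq_length_filter]
  refine List.countP_mono_left fun j _ hj => ?_
  simp only [decide_eq_true_eq] at hj ⊢
  omega

/-- The minimal right coset representatives of `S_μ` are the permutations whose inverse is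
increasing on every block of `μ`. -/
theorem mem_Dset_iff {n : ℕ} {μ : List ℕ} {d : Equiv.Perm (Fin n)} :
    d ∈ Dset n μ ↔
      ∀ a c : Fin n, a < c → blockOf μ a = blockOf μ c → d⁻¹ a < d⁻¹ c := by
  classical
  simp only [Dset, youngSet, Finset.mem_filter, Finset.mem_univ, true_and]
  constructor
  · intro h
    have adj : ∀ (a : ℕ) (ha : a + 1 < n), blockOf μ a = blockOf μ (a + 1) →
        d⁻¹ ⟨a, by omega⟩ < d⁻¹ ⟨a + 1, ha⟩ := by
      intro a ha hb
      by_contra hlt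
      set x : Fin n := ⟨a, by omega⟩ with hx
      set y : Fin n := ⟨a + 1, ha⟩ with hy
      have hxy : x < y := by simp [hx, hy]
      have hmem : ∀ z : Fin n, blockOf μ (Equiv.swap x y z) = blockOf μ z := by
        intro z
        rw [Equiv.swap_apply_def]
        split_ifs with h1 h2
        · rw [h1]; exact hb.symm
        · rw [h2]; exact hb
        · rfl
      have key := len_mul_of_forall_lt (Equiv.swap x y) (Equiv.swap x y * d) (by
        intro p q hpq hinv
        simp only [Equiv.Perm.mul_apply, Equiv.swap_apply_self] at hinv ⊢
        by_contra hge
        have hne : d p ≠ d q := fun heq => hpq.ne (d.injective heq)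
        have hpx : d p = x ∧ d q = y := by
          rw [Equiv.swap_apply_def, Equiv.swap_apply_def] at hinv
          simp only [hx, hy, Fin.ext_iff, Fin.lt_def] at *
          grind
        apply hlt
        rw [← hpx.1, ← hpx.2]
        simpa using hpq)
      rw [← mul_assoc, Equiv.swap_mul_self, one_mul] at key
      have hpos : 0 < len (Equiv.swap x y) := by
        unfold len
        refine Finset.card_pos.2 ⟨(x, y), ?_⟩
        simpa using hxy
      have := h _ hmem
      omega
    rintro ⟨a, ha⟩ ⟨c, hc⟩ hac hb
    simp only [Fin.mk_lt_mk] at hac hb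
    induction c, (show a + 1 ≤ c from hac) using Nat.le_induction with
    | base => exact adj a hc hb
    | succ c hac' ih =>
      have h1 := blockOf_mono μ (show a ≤ c by omega)
      have h2 := blockOf_mono μ (show c ≤ c + 1 by omega)
      exact (ih (by omega) (by omega) (by omega)).trans (adj c hc (by omega))
  · intro h u hu
    rw [len_mul_of_forall_lt u d]
    · exact Nat.le_add_left _ _
    · intro p q hpq hinv
      have hne : blockOf μ (d q) ≠ blockOf μ (d p) := fun heq => by
        have := h _ _ hinv heq
        simp only [Equiv.Perm.coe_inv, Equiv.symm_apply_apply] at this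
        exact lt_asymm this hpq
      rw [← hu, ← hu (d p)] at hne
      by_contra hge
      have h1 := blockOf_mono μ (Fin.le_def.1 (not_lt.1 hge))
      have h2 := blockOf_mono μ (Fin.le_def.1 hinv.le)
      rw [hu, hu] at h1
      rw [hu, hu] at hne
      exact hne (le_antisymm h2 h1)

theorem shiftEmb_apply {n k m : ℕ} (h : k + m ≤ n) (w : Equiv.Perm (Fin m)) (i : Fin m) :
    shiftEmb n k m w ⟨k + i, by omega⟩ = ⟨k + w i, by omega⟩ := by
  rw [shiftEmb, dif_pos h]
  exact w.extendDomain_apply_image (shiftEquiv n k m h) i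

theorem shiftEmb_apply_of_not_mem {n k m : ℕ} (h : k + m ≤ n) (w : Equiv.Perm (Fin m))
    (a : Fin n) (ha : ¬(k ≤ (a : ℕ) ∧ (a : ℕ) < k + m)) :
    shiftEmb n k m w a = a := by
  rw [shiftEmb, dif_pos h]
  exact w.extendDomain_apply_not_subtype (shiftEquiv n k m h) ha

theorem shiftEmb_inv {n k m : ℕ} (h : k + m ≤ n) (w : Equiv.Perm (Fin m)) :
    (shiftEmb n k m w)⁻¹ = shiftEmb n k m w⁻¹ := by
  rw [shiftEmb, shiftEmb, dif_pos h, dif_pos h, Equiv.Perm.extendDomain_inv]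

theorem exists_shiftEmb_eq {n k m : ℕ} (h : k + m ≤ n) (d : Equiv.Perm (Fin n))
    (hd : ∀ a : Fin n, ¬(k ≤ (a : ℕ) ∧ (a : ℕ) < k + m) → d a = a) :
    ∃ w, shiftEmb n k m w = d := by
  classical
  have hd' : ∀ a : Fin n, (k ≤ (d a : ℕ) ∧ (d a : ℕ) < k + m) ↔
      (k ≤ (a : ℕ) ∧ (a : ℕ) < k + m) := by
    intro a
    constructor
    · intro h1
      by_contra h2
      rw [hd a h2] at h1
      exact h2 h1
    · intro h1
      by_contra h2
      rw [d.injective (hd _ h2)] at h2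
      exact h2 h1
  refine ⟨(shiftEquiv n k m h).symm.permCongr (d.subtypePerm hd'), ?_⟩
  ext a
  rw [shiftEmb, dif_pos h]
  by_cases ha : k ≤ (a : ℕ) ∧ (a : ℕ) < k + m
  · rw [Equiv.Perm.extendDomain_apply_subtype _ (shiftEquiv n k m h) ha]
    simp [Equiv.permCongr_apply]
  · rw [Equiv.Perm.extendDomain_apply_not_subtype _ (shiftEquiv n k m h) ha, hd a ha]

theorem mem_image_Dset_iff {n k m : ℕ} (h : k + m ≤ n) {μ : List ℕ} {d : Equiv.Perm (Fin n)} :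
    d ∈ (Dset m μ).image (shiftEmb n k m) ↔
      (∀ a : Fin n, ¬(k ≤ (a : ℕ) ∧ (a : ℕ) < k + m) → d a = a) ∧
      ∀ a c : Fin n, k ≤ (a : ℕ) → a < c → (c : ℕ) < k + m →
        blockOf μ (a - k) = blockOf μ (c - k) → d⁻¹ a < d⁻¹ c := by
  simp only [Finset.mem_image, mem_Dset_iff]
  have key : ∀ (w : Equiv.Perm (Fin m)) (a : Fin n) (ha : k ≤ (a : ℕ) ∧ (a : ℕ) < k + m),
      ((shiftEmb n k m w)⁻¹ a : ℕ) = k + w⁻¹ ⟨a - k, by omega⟩ := by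
    intro w a ha
    have h1 := shiftEmb_apply h w⁻¹ ⟨a - k, by omega⟩
    have h2 : (⟨k + ((⟨a - k, by omega⟩ : Fin m) : ℕ), by simp only; omega⟩ : Fin n) = a :=
      Fin.ext (by simp only; omega)
    rw [h2] at h1
    rw [shiftEmb_inv h, h1]
  constructor
  · rintro ⟨w, hw, rfl⟩
    refine ⟨shiftEmb_apply_of_not_mem h w, fun a c ha hac hc hb => ?_⟩
    rw [Fin.lt_def, key w a ⟨ha, by omega⟩, key w c ⟨by omega, hc⟩]
    have := hw ⟨a - k, by omega⟩ ⟨c - k, by omega⟩ (by simp only [Fin.mk_lt_mk]; omega) hb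
    rw [Fin.lt_def] at this
    omega
  · rintro ⟨hd, hd'⟩
    obtain ⟨w, rfl⟩ := exists_shiftEmb_eq h d hd
    refine ⟨w, fun a c hac hb => ?_, rfl⟩
    have := hd' ⟨k + a, by omega⟩ ⟨k + c, by omega⟩ (by simp) (by simpa using hac)
      (by simp) (by simpa using hb)
    rw [Fin.lt_def, key w _ (by simp), key w _ (by simp)] at this
    simp only [Nat.add_sub_cancel_left, Fin.eta] at this
    rw [Fin.lt_def]
    omega

theorem mem_Hset_four_two_iff {w : Equiv.Perm (Fin 4)} :
    w ∈ Hset 4 2 ↔ w⁻¹ 0 = 0 ∧ w⁻¹ 2 < w⁻¹ 3 := by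
  have dec : ∀ e : Equiv.Perm (Fin 4),
      (e 0 < e 2 ∧ (e 0 < e 1 ∧ e 2 < e 3)) ↔ (e 0 = 0 ∧ e 2 < e 3) := by decide
  rw [← dec w⁻¹]
  simp [Hset, pimg, Finset.Icc_eq_empty_of_lt, show Finset.Icc 1 2 = {1, 2} from rfl]

theorem mem_image_Hset_four_two_iff {n : ℕ} (h : 4 ≤ n) {d : Equiv.Perm (Fin n)} :
    d ∈ (Hset 4 2).image (shiftEmb n 0 4) ↔
      (∀ a : Fin n, (a : ℕ) = 0 ∨ 4 ≤ (a : ℕ) → d a = a) ∧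
      d⁻¹ ⟨2, by omega⟩ < d⁻¹ ⟨3, by omega⟩ := by
  have h' : 0 + 4 ≤ n := by omega
  have key : ∀ (w : Equiv.Perm (Fin 4)) (i : Fin 4),
      (shiftEmb n 0 4 w)⁻¹ ⟨i, by omega⟩ = ⟨w⁻¹ i, by omega⟩ := by
    intro w i
    have := shiftEmb_apply h' w⁻¹ i
    simpa [shiftEmb_inv h'] using this
  have key2 := fun w => key w 2
  have key3 := fun w => key w 3
  have key0 := fun w => key w 0
  simp only [Finset.mem_image, mem_Hset_four_two_iff]
  constructor
  · rintro ⟨w, ⟨hw0, hw⟩, rfl⟩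
    refine ⟨?_, ?_⟩
    · rintro a (ha | ha)
      · rw [← Equiv.Perm.eq_inv_iff_eq]
        have := key0 w
        simp only [hw0] at this
        rw [show a = ⟨0, by omega⟩ from Fin.ext ha]
        exact this.symm
      · exact shiftEmb_apply_of_not_mem h' w a (by omega)
    · exact (key2 w).trans_lt (lt_of_lt_of_eq hw (key3 w).symm)
  · rintro ⟨hd, hd'⟩
    obtain ⟨w, rfl⟩ := exists_shiftEmb_eq h' d fun a ha => hd a (by omega)
    refine ⟨w, ⟨?_, ?_⟩, rfl⟩
    · have h0 := hd ⟨0, by omega⟩ (Or.inl rfl)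
      rw [← Equiv.Perm.eq_inv_iff_eq] at h0
      exact Fin.ext (Fin.ext_iff.1 (h0.trans (key0 w))).symm
    · exact ((key2 w).symm.trans_lt hd').trans_eq (key3 w)

theorem blockOf_pair (a b k : ℕ) (hk : k < a + b) :
    blockOf [a, b] k = if k < a then 0 else 1 := by
  simp only [blockOf, List.length_cons, List.length_nil,
    show List.range (0 + 1 + 1) = [0, 1] from rfl]
  simp [List.filter_cons, hk]
  split_ifs <;> grind

theorem blockOf_triple (a b c k : ℕ) (hk : k < a + b + c) :
    blockOf [a, b, c] k = if k < a then 0 else if k < a + b then 1 else 2 := by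
  simp only [blockOf, List.length_cons, List.length_nil,
    show List.range (0 + 1 + 1 + 1) = [0, 1, 2] from rfl]
  simp [List.filter_cons]
  split_ifs <;> grind

theorem mem_image_Dset_three_iff {n : ℕ} (h : 4 ≤ n) {d : Equiv.Perm (Fin n)} :
    d ∈ (Dset (n - 1) [3, n - 4]).image (shiftEmb n 1 (n - 1)) ↔
      (∀ a : Fin n, (a : ℕ) = 0 → d a = a) ∧
      ∀ a c : Fin n, 1 ≤ (a : ℕ) → a < c → ((c : ℕ) < 4 ∨ 4 ≤ (a : ℕ)) → d⁻¹ a < d⁻¹ c := by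
  rw [mem_image_Dset_iff (by omega)]
  refine and_congr (forall_congr' fun a => imp_congr (by omega) Iff.rfl)
    (forall_congr' fun a => forall_congr' fun c => ?_)
  have key : a < c → 1 ≤ (a : ℕ) → ((c : ℕ) < 4 ∨ 4 ≤ (a : ℕ) ↔
      blockOf [3, n - 4] (a - 1) = blockOf [3, n - 4] (c - 1)) := by
    intro hac ha
    rw [Fin.lt_def] at hac
    rw [blockOf_pair _ _ _ (by omega), blockOf_pair _ _ _ (by omega)]
    grind
  have hc : (c : ℕ) < 1 + (n - 1) := by omega
  tauto

theorem mem_image_Dset_one_two_iff {n : ℕ} (h : 4 ≤ n) {d : Equiv.Perm (Fin n)} :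
    d ∈ (Dset (n - 1) [1, 2, n - 4]).image (shiftEmb n 1 (n - 1)) ↔
      (∀ a : Fin n, (a : ℕ) = 0 → d a = a) ∧
      ∀ a c : Fin n, 2 ≤ (a : ℕ) → a < c → ((c : ℕ) < 4 ∨ 4 ≤ (a : ℕ)) → d⁻¹ a < d⁻¹ c := by
  rw [mem_image_Dset_iff (by omega)]
  refine and_congr (forall_congr' fun a => imp_congr (by omega) Iff.rfl)
    (forall_congr' fun a => forall_congr' fun c => ?_)
  have key : a < c → 1 ≤ (a : ℕ) → (2 ≤ (a : ℕ) ∧ ((c : ℕ) < 4 ∨ 4 ≤ (a : ℕ)) ↔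
      blockOf [1, 2, n - 4] (a - 1) = blockOf [1, 2, n - 4] (c - 1)) := by
    intro hac ha
    rw [Fin.lt_def] at hac
    rw [blockOf_triple _ _ _ _ (by omega), blockOf_triple _ _ _ _ (by omega)]
    grind
  have hc : (c : ℕ) < 1 + (n - 1) := by omega
  have ha : 2 ≤ (a : ℕ) → 1 ≤ (a : ℕ) := by omega
  tauto

/-- A permutation fixing every point outside `{1, 2, 3}` preserves `{1, 2, 3}`. -/
theorem inv_apply_mem_of_fixes {n : ℕ} {d : Equiv.Perm (Fin n)}
    (hd : ∀ a : Fin n, (a : ℕ) = 0 ∨ 4 ≤ (a : ℕ) → d a = a) (a : Fin n)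
    (ha : 1 ≤ (a : ℕ) ∧ (a : ℕ) < 4) : 1 ≤ (d⁻¹ a : ℕ) ∧ (d⁻¹ a : ℕ) < 4 := by
  by_contra hcon
  have h1 := hd (d⁻¹ a) (by omega)
  rw [Equiv.Perm.coe_inv, Equiv.apply_symm_apply] at h1
  rw [Equiv.Perm.coe_inv, ← h1] at hcon
  exact hcon ha

/-- A permutation `e` with `e 2 < e 3` becomes increasing on `{1, 2, 3}` after composition with an
element of the image of `H_2(4)`. -/
theorem exists_sort {n : ℕ} (h : 4 ≤ n) (e : Equiv.Perm (Fin n))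
    (he : e ⟨2, by omega⟩ < e ⟨3, by omega⟩) :
    ∃ d : Equiv.Perm (Fin n), ((∀ a : Fin n, (a : ℕ) = 0 ∨ 4 ≤ (a : ℕ) → d a = a) ∧
      d⁻¹ ⟨2, by omega⟩ < d⁻¹ ⟨3, by omega⟩) ∧
      e (d ⟨1, by omega⟩) < e (d ⟨2, by omega⟩) ∧ e (d ⟨2, by omega⟩) < e (d ⟨3, by omega⟩) := by
  have hne : ∀ i j : Fin n, i ≠ j → e i ≠ e j := fun i j hij => e.injective.ne hij
  have h12 := hne ⟨1, by omega⟩ ⟨2, by omega⟩ (by simp)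
  have h13 := hne ⟨1, by omega⟩ ⟨3, by omega⟩ (by simp)
  rcases lt_or_gt_of_ne h12 with hlt | hgt
  · exact ⟨1, by simp, hlt, he⟩
  rcases lt_or_gt_of_ne h13 with hlt' | hgt'
  · refine ⟨Equiv.swap ⟨1, by omega⟩ ⟨2, by omega⟩, ⟨fun a ha => ?_, ?_⟩, ?_, ?_⟩
    · exact Equiv.swap_apply_of_ne_of_ne (by rw [Ne, Fin.ext_iff]; simp only; omega)
        (by rw [Ne, Fin.ext_iff]; simp only; omega)
    all_goals simp [Equiv.swap_apply_def, *]
  · refine ⟨Equiv.swap ⟨1, by omega⟩ ⟨2, by omega⟩ * Equiv.swap ⟨2, by omega⟩ ⟨3, by omega⟩,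
      ⟨fun a ha => ?_, ?_⟩, ?_, ?_⟩
    · have hn : ∀ i (hi : i < n), 1 ≤ i → i < 4 → a ≠ ⟨i, hi⟩ := fun i hi h1 h4 hai => by
        rw [Fin.ext_iff] at hai
        simp only at hai
        omega
      rw [Equiv.Perm.mul_apply, Equiv.swap_apply_of_ne_of_ne (hn 2 _ _ _) (hn 3 _ _ _),
        Equiv.swap_apply_of_ne_of_ne (hn 1 _ _ _) (hn 2 _ _ _)] <;> omega
    all_goals simp [Equiv.swap_apply_def, *]

/-- For `f ≥ 2` and `n = 2f`,
`Ĥ₂^{{1,2,3,4}} · D̂_{(3,2f-4)}^{{2,…,2f}} = D̂_{(1,2,2f-4)}^{{2,…,2f}}`. -/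
theorem statement8 {F : Type*} [Field F] {A : Type*} [Ring A] [Algebra F A]
    {f : ℕ} (hf : 2 ≤ f) {q r : F} (D : BMWData F A (2 * f) q r) :
    hat q D.Tw ((Hset 4 2).image (shiftEmb (2 * f) 0 4)) *
      hat q D.Tw ((Dset (2 * f - 1) [3, 2 * f - 4]).image (shiftEmb (2 * f) 1 (2 * f - 1))) =
    hat q D.Tw
      ((Dset (2 * f - 1) [1, 2, 2 * f - 4]).image (shiftEmb (2 * f) 1 (2 * f - 1))) := by
  have h4 : 4 ≤ 2 * f := by omega
  have p1 : 1 < 2 * f := by omega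
  have p2 : 2 < 2 * f := by omega
  have p3 : 3 < 2 * f := by omega
  unfold hat
  rw [Finset.sum_mul_sum, ← Finset.sum_product']
  refine Finset.sum_bij (fun p _ => p.1 * p.2) ?_ ?_ ?_ ?_
  · rintro ⟨d₁, d₂⟩ hp
    rw [Finset.mem_product, mem_image_Hset_four_two_iff h4, mem_image_Dset_three_iff h4] at hp
    obtain ⟨⟨h₁, h₁'⟩, h₂, h₂'⟩ := hp
    rw [mem_image_Dset_one_two_iff h4]
    refine ⟨fun a ha => ?_, fun a c ha hac hc => ?_⟩
    · rw [Equiv.Perm.mul_apply, h₂ a ha, h₁ a (Or.inl ha)]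
    · rw [mul_inv_rev, Equiv.Perm.mul_apply, Equiv.Perm.mul_apply]
      rcases hc with hc | hc
      · obtain rfl : a = ⟨2, p2⟩ := Fin.ext (by simp only; omega)
        obtain rfl : c = ⟨3, p3⟩ := Fin.ext (by simp only; omega)
        exact h₂' _ _ (inv_apply_mem_of_fixes h₁ _ (by simp)).1 h₁'
          (Or.inl (inv_apply_mem_of_fixes h₁ _ (by simp)).2)
      · rw [Equiv.Perm.inv_eq_iff_eq.2 (h₁ a (Or.inr hc)).symm,
          Equiv.Perm.inv_eq_iff_eq.2 (h₁ c (Or.inr (by omega))).symm]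
        exact h₂' a c (by omega) hac (Or.inr hc)
  · rintro ⟨d₁, d₂⟩ hp ⟨d₁', d₂'⟩ hp' heq
    rw [Finset.mem_product, mem_image_Hset_four_two_iff h4, mem_image_Dset_three_iff h4] at hp hp'
    obtain ⟨⟨h₁, -⟩, -, h₂⟩ := hp
    obtain ⟨⟨h₁', -⟩, -, h₂'⟩ := hp'
    simp only at heq h₁ h₂ h₁' h₂'
    have hlt : ∀ a c : Fin (2 * f), 1 ≤ (a : ℕ) ∧ (a : ℕ) < 4 → 1 ≤ (c : ℕ) ∧ (c : ℕ) < 4 →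
        d₁⁻¹ a < d₁⁻¹ c → d₁'⁻¹ a < d₁'⁻¹ c := by
      intro a c ha hc hac
      have hlt₂ := h₂ _ _ (inv_apply_mem_of_fixes h₁ a ha).1 hac
        (Or.inl (inv_apply_mem_of_fixes h₁ c hc).2)
      rw [← Equiv.Perm.mul_apply, ← Equiv.Perm.mul_apply, ← mul_inv_rev, heq, mul_inv_rev,
        Equiv.Perm.mul_apply, Equiv.Perm.mul_apply] at hlt₂
      by_contra hge
      rcases (not_lt.1 hge).lt_or_eq with hlt' | heq'
      · exact lt_asymm hlt₂ (h₂' _ _ (inv_apply_mem_of_fixes h₁' c hc).1 hlt'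
          (Or.inl (inv_apply_mem_of_fixes h₁' a ha).2))
      · rw [heq'] at hlt₂
        exact lt_irrefl _ hlt₂
    have hd : d₁ = d₁' := by
      rw [← inv_inj]
      have hne : ∀ i j : Fin (2 * f), i ≠ j → (d₁⁻¹ i : ℕ) ≠ d₁⁻¹ j :=
        fun i j hij heq => hij (d₁⁻¹.injective (Fin.ext heq))
      have r1 := inv_apply_mem_of_fixes h₁ ⟨1, p1⟩ (by simp)
      have r2 := inv_apply_mem_of_fixes h₁ ⟨2, p2⟩ (by simp)
      have r3 := inv_apply_mem_of_fixes h₁ ⟨3, p3⟩ (by simp)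
      have r1' := inv_apply_mem_of_fixes h₁' ⟨1, p1⟩ (by simp)
      have r2' := inv_apply_mem_of_fixes h₁' ⟨2, p2⟩ (by simp)
      have r3' := inv_apply_mem_of_fixes h₁' ⟨3, p3⟩ (by simp)
      have n12 := hne ⟨1, p1⟩ ⟨2, p2⟩ (by simp)
      have n13 := hne ⟨1, p1⟩ ⟨3, p3⟩ (by simp)
      have n23 := hne ⟨2, p2⟩ ⟨3, p3⟩ (by simp)
      have l12 := hlt ⟨1, p1⟩ ⟨2, p2⟩ (by simp) (by simp)
      have l21 := hlt ⟨2, p2⟩ ⟨1, p1⟩ (by simp) (by simp)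
      have l13 := hlt ⟨1, p1⟩ ⟨3, p3⟩ (by simp) (by simp)
      have l31 := hlt ⟨3, p3⟩ ⟨1, p1⟩ (by simp) (by simp)
      have l23 := hlt ⟨2, p2⟩ ⟨3, p3⟩ (by simp) (by simp)
      have l32 := hlt ⟨3, p3⟩ ⟨2, p2⟩ (by simp) (by simp)
      rw [Fin.lt_def, Fin.lt_def] at l12 l21 l13 l31 l23 l32
      refine Equiv.ext fun a => ?_
      by_cases ha : (a : ℕ) = 0 ∨ 4 ≤ (a : ℕ)
      · rw [Equiv.Perm.inv_eq_iff_eq.2 (h₁ a ha).symm, Equiv.Perm.inv_eq_iff_eq.2 (h₁' a ha).symm]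
      · have ha' : a = ⟨1, p1⟩ ∨ a = ⟨2, p2⟩ ∨ a = ⟨3, p3⟩ := by
          simp only [Fin.ext_iff]
          omega
        rcases ha' with rfl | rfl | rfl <;> exact Fin.ext (by omega)
    subst hd
    rw [mul_left_cancel heq]
  · intro d hd
    rw [mem_image_Dset_one_two_iff h4] at hd
    obtain ⟨hd, hd'⟩ := hd
    obtain ⟨d₁, h₁, h12, h23⟩ := exists_sort h4 d⁻¹
      (hd' ⟨2, p2⟩ ⟨3, p3⟩ (by simp) (by simp) (by simp))
    refine ⟨(d₁, d₁⁻¹ * d), ?_, mul_inv_cancel_left _ _⟩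
    rw [Finset.mem_product, mem_image_Hset_four_two_iff h4, mem_image_Dset_three_iff h4]
    refine ⟨h₁, fun a ha => ?_, fun a c ha hac hc => ?_⟩
    · rw [Equiv.Perm.mul_apply, hd a ha]
      exact Equiv.Perm.inv_eq_iff_eq.2 (h₁.1 a (Or.inl ha)).symm
    · rw [mul_inv_rev, inv_inv, Equiv.Perm.mul_apply, Equiv.Perm.mul_apply]
      rcases hc with hc | hc
      · have : (a = ⟨1, p1⟩ ∧ c = ⟨2, p2⟩) ∨ (a = ⟨1, p1⟩ ∧ c = ⟨3, p3⟩) ∨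
            (a = ⟨2, p2⟩ ∧ c = ⟨3, p3⟩) := by
          simp only [Fin.ext_iff]
          omega
        rcases this with ⟨rfl, rfl⟩ | ⟨rfl, rfl⟩ | ⟨rfl, rfl⟩
        · exact h12
        · exact h12.trans h23
        · exact h23
      · rw [h₁.1 a (Or.inr hc), h₁.1 c (Or.inr (by omega))]
        exact hd' a c (by omega) hac (Or.inr hc)
  · rintro ⟨d₁, d₂⟩ hp
    rw [Finset.mem_product, mem_image_Hset_four_two_iff h4, mem_image_Dset_three_iff h4] at hp
    obtain ⟨⟨h₁, -⟩, h₂, h₂'⟩ := hp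
    simp only at h₁ h₂ h₂'
    have hlen : len (d₁ * d₂) = len d₁ + len d₂ := by
      refine len_mul_of_forall_lt d₁ d₂ fun p r hpr hinv => ?_
      have hout : ¬(1 ≤ (d₂ r : ℕ) ∧ (d₂ p : ℕ) < 4) := fun hin => by
        have := h₂' _ _ hin.1 hinv (Or.inl hin.2)
        simp only [Equiv.Perm.coe_inv, Equiv.symm_apply_apply] at this
        exact lt_asymm this hpr
      have hmem : ∀ x : Fin (2 * f), 1 ≤ (x : ℕ) ∧ (x : ℕ) < 4 →
          1 ≤ (d₁ x : ℕ) ∧ (d₁ x : ℕ) < 4 := fun x hx => by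
        by_contra hcon
        rw [d₁.injective (h₁ (d₁ x) (by omega))] at hcon
        exact hcon hx
      have hp := hmem (d₂ p)
      have hr := hmem (d₂ r)
      have hp' := fun hx => Fin.ext_iff.1 (h₁ (d₂ p) hx)
      have hr' := fun hx => Fin.ext_iff.1 (h₁ (d₂ r) hx)
      rw [Fin.lt_def] at hinv ⊢
      omega
    rw [smul_mul_smul_comm, ← pow_add, ← hlen, ← D.Tw_mul _ _ hlen]

end BMWPaper
end

section
/- Let f ≥ 1 and work in S_{2f}. The map sending the i-th adjacent transposition of the symmetric group S_f to 𝕤_i extends to a group isomorphism from S_f onto the subgroup 𝕊_f = ⟨𝕤_1,…,𝕤_{f−1}⟩ of S_{2f}, and D_{(2,2,…,2)} (f twos) = 𝕊_f · H_f(2f), with every d ∈ D_{(2,2,…,2)} written uniquely as d = w·d' with w ∈ 𝕊_f and d' ∈ H_f(2f). -/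
open Finset
open scoped Pointwise

namespace BMWPaper

/-- The first point of the `i`-th block `{2i, 2i+1}` (0-based). -/
def blockFst {f : ℕ} (i : Fin f) : Fin (2 * f) := ⟨2 * i, by omega⟩

/-- The second point of the `i`-th block `{2i, 2i+1}` (0-based). -/
def blockSnd {f : ℕ} (i : Fin f) : Fin (2 * f) := ⟨2 * i + 1, by omega⟩

theorem blockFst_injective {f : ℕ} : Function.Injective (blockFst (f := f)) := by
  intro i j h
  simp only [blockFst, Fin.mk.injEq] at h
  omega

theorem exists_eq_blockFst_or_blockSnd {f : ℕ} (x : Fin (2 * f)) :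
    ∃ i, x = blockFst i ∨ x = blockSnd i := by
  refine ⟨⟨x / 2, by omega⟩, ?_⟩
  simp only [blockFst, blockSnd, Fin.ext_iff]
  omega

/-- The map on `Fin (2 * f)` permuting the blocks `{2i, 2i+1}` according to `σ`. -/
def blockMap {f : ℕ} (σ : Fin f → Fin f) (x : Fin (2 * f)) : Fin (2 * f) :=
  ⟨2 * (σ ⟨x / 2, by omega⟩ : ℕ) + x % 2, by omega⟩

theorem blockMap_blockFst {f : ℕ} (σ : Fin f → Fin f) (i : Fin f) :
    blockMap σ (blockFst i) = blockFst (σ i) := by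
  simp [blockMap, blockFst]

theorem blockMap_blockSnd {f : ℕ} (σ : Fin f → Fin f) (i : Fin f) :
    blockMap σ (blockSnd i) = blockSnd (σ i) := by
  have h : (2 * (i : ℕ) + 1) / 2 = i := by omega
  simp [blockMap, blockSnd, h, Nat.add_mod]

theorem blockMap_comp {f : ℕ} (σ τ : Fin f → Fin f) (x : Fin (2 * f)) :
    blockMap σ (blockMap τ x) = blockMap (σ ∘ τ) x := by
  obtain ⟨i, rfl | rfl⟩ := exists_eq_blockFst_or_blockSnd x <;>
    simp [blockMap_blockFst, blockMap_blockSnd]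

theorem blockMap_id {f : ℕ} (x : Fin (2 * f)) : blockMap id x = x := by
  obtain ⟨i, rfl | rfl⟩ := exists_eq_blockFst_or_blockSnd x <;>
    simp [blockMap_blockFst, blockMap_blockSnd]

/-- The embedding of `S_f` into `S_{2f}` by permutations of the blocks `{2i, 2i+1}`. -/
def blockHom (f : ℕ) : Equiv.Perm (Fin f) →* Equiv.Perm (Fin (2 * f)) :=
  MonoidHom.mk'
    (fun σ =>
      { toFun := blockMap σ
        invFun := blockMap σ.symm
        left_inv := fun x => by rw [blockMap_comp, Equiv.symm_comp_self, blockMap_id]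
        right_inv := fun x => by rw [blockMap_comp, Equiv.self_comp_symm, blockMap_id] })
    (fun σ τ => Equiv.ext fun x => (blockMap_comp σ τ x).symm)

theorem blockHom_apply {f : ℕ} (σ : Equiv.Perm (Fin f)) (x : Fin (2 * f)) :
    blockHom f σ x = blockMap σ x := rfl

theorem blockHom_blockFst {f : ℕ} (σ : Equiv.Perm (Fin f)) (i : Fin f) :
    blockHom f σ (blockFst i) = blockFst (σ i) := blockMap_blockFst σ i

theorem blockHom_blockSnd {f : ℕ} (σ : Equiv.Perm (Fin f)) (i : Fin f) :
    blockHom f σ (blockSnd i) = blockSnd (σ i) := blockMap_blockSnd σ i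

theorem blockHom_injective (f : ℕ) : Function.Injective (blockHom f) := by
  intro σ τ h
  ext1 i
  apply blockFst_injective
  rw [← blockHom_blockFst, h, blockHom_blockFst]

theorem sGen_apply_val {n i : ℕ} (h₁ : 1 ≤ i) (h₂ : i < n) (x : Fin n) :
    (sGen n i x : ℕ) = if (x : ℕ) = i - 1 then i else if (x : ℕ) = i then i - 1 else x := by
  rw [sGen, dif_pos ⟨h₁, h₂⟩, Equiv.swap_apply_def]
  simp only [Fin.ext_iff]
  split_ifs <;> rfl

theorem blockHom_sGen {f i : ℕ} (h₁ : 1 ≤ i) (h₂ : i ≤ f - 1) :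
    blockHom f (sGen f i) = bbs (2 * f) i := by
  ext x
  have hx := x.isLt
  simp only [blockHom_apply, blockMap, bbs, Equiv.Perm.mul_apply]
  have h := sGen_apply_val (n := f) h₁ (by omega) ⟨x / 2, by omega⟩
  have ha := sGen_apply_val (i := 2 * i) (by omega) (by omega) x
  set a := sGen (2 * f) (2 * i) x
  have hb := sGen_apply_val (i := 2 * i + 1) (by omega) (by omega) a
  set b := sGen (2 * f) (2 * i + 1) a
  have hc := sGen_apply_val (i := 2 * i - 1) (by omega) (by omega) b
  set c := sGen (2 * f) (2 * i - 1) b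
  have hd := sGen_apply_val (i := 2 * i) (by omega) (by omega) c
  simp only at h
  split_ifs at h <;> split_ifs at ha <;> try omega
  all_goals split_ifs at hb <;> try omega
  all_goals split_ifs at hc <;> try omega
  all_goals split_ifs at hd <;> omega

theorem closure_sGen (f : ℕ) :
    Subgroup.closure {w | ∃ i, 1 ≤ i ∧ i ≤ f - 1 ∧ w = sGen f i} = ⊤ := by
  rcases f with _ | n
  · exact Subsingleton.elim _ _
  rw [← Subgroup.toSubmonoid_inj, Subgroup.top_toSubmonoid, eq_top_iff,
    ← Equiv.Perm.mclosure_swap_castSucc_succ n, Submonoid.closure_le]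
  rintro _ ⟨i, rfl⟩
  refine Subgroup.subset_closure ⟨i + 1, by omega, by omega, ?_⟩
  rw [sGen, dif_pos ⟨by omega, by omega⟩]
  rfl

theorem range_blockHom (f : ℕ) :
    (blockHom f).range =
      Subgroup.closure {w | ∃ i, 1 ≤ i ∧ i ≤ f - 1 ∧ w = bbs (2 * f) i} := by
  rw [MonoidHom.range_eq_map, ← closure_sGen, MonoidHom.map_closure]
  congr 1
  ext w
  constructor
  · rintro ⟨_, ⟨i, h₁, h₂, rfl⟩, rfl⟩
    exact ⟨i, h₁, h₂, blockHom_sGen h₁ h₂⟩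
  · rintro ⟨i, h₁, h₂, rfl⟩
    exact ⟨_, ⟨i, h₁, h₂, rfl⟩, blockHom_sGen h₁ h₂⟩

theorem blockOf_replicate_two {f k : ℕ} (hk : k < 2 * f) :
    blockOf (List.replicate f 2) k = k / 2 := by
  have h : (List.range f).filter (fun j => ((List.replicate f 2).take (j + 1)).sum ≤ k) =
      (List.range f).filter (fun j => j < k / 2) := by
    refine List.filter_congr fun j hj => ?_
    have hj := List.mem_range.mp hj
    simp only [List.take_replicate, List.sum_replicate, smul_eq_mul, decide_eq_decide]
    omega
  rw [blockOf, List.length_replicate, h, ← List.toFinset_card_of_nodup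
    (List.nodup_range.filter _)]
  have h' : ((List.range f).filter (fun j => j < k / 2)).toFinset = Finset.range (k / 2) := by
    ext j
    simp only [List.mem_toFinset, List.mem_filter, List.mem_range, decide_eq_true_eq,
      Finset.mem_range]
    omega
  rw [h', Finset.card_range]

theorem mem_youngSet_replicate_two {f : ℕ} {u : Equiv.Perm (Fin (2 * f))} :
    u ∈ youngSet (2 * f) (List.replicate f 2) ↔ ∀ a, (u a : ℕ) / 2 = a / 2 := by
  simp [youngSet, blockOf_replicate_two]

theorem mem_Dset_replicate_two {f : ℕ} {d : Equiv.Perm (Fin (2 * f))} :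
    d ∈ Dset (2 * f) (List.replicate f 2) ↔ ∀ i, d⁻¹ (blockFst i) < d⁻¹ (blockSnd i) := by
  simp only [Dset, Finset.mem_filter, Finset.mem_univ, true_and]
  constructor
  · intro h i
    by_contra! hi
    have hlt : d⁻¹ (blockSnd i) < d⁻¹ (blockFst i) :=
      lt_of_le_of_ne hi fun h => by
        have := d⁻¹.injective h
        simp [blockFst, blockSnd] at this
    have hval : ∀ a : Fin (2 * f), (Equiv.swap (blockFst i) (blockSnd i) a : ℕ) =
        if (a : ℕ) = 2 * i then 2 * (i : ℕ) + 1
        else if (a : ℕ) = 2 * i + 1 then 2 * (i : ℕ) else (a : ℕ) := by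
      intro a
      rw [Equiv.swap_apply_def]
      simp only [blockFst, blockSnd, Fin.ext_iff]
      split_ifs <;> rfl
    refine (h (Equiv.swap (blockFst i) (blockSnd i)) ?_).not_gt ?_
    · rw [mem_youngSet_replicate_two]
      intro a
      rw [hval]
      split_ifs <;> omega
    · refine Finset.card_lt_card (Finset.ssubset_iff_of_subset ?_ |>.mpr
        ⟨(d⁻¹ (blockSnd i), d⁻¹ (blockFst i)), ?_, ?_⟩)
      · rintro ⟨x, y⟩ hxy
        simp only [Finset.mem_filter, Finset.mem_univ, true_and, Equiv.Perm.mul_apply,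
          Fin.lt_def, hval] at hxy ⊢
        refine ⟨hxy.1, ?_⟩
        have hxy' : ¬((d x : ℕ) = 2 * i ∧ (d y : ℕ) = 2 * i + 1) := by
          rintro ⟨hx, hy⟩
          have hx : d x = blockFst i := Fin.ext hx
          have hy : d y = blockSnd i := Fin.ext hy
          rw [← hy, ← hx, Equiv.Perm.inv_def, Equiv.symm_apply_apply,
            Equiv.symm_apply_apply] at hi
          exact absurd hxy.1 (Nat.not_lt.mpr hi)
        have hne : (d x : ℕ) ≠ d y := fun h => by
          have := d.injective (Fin.ext h)
          have := hxy.1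
          simp_all
        have := hxy.2
        split_ifs at this <;> omega
      · simp only [Finset.mem_filter, Finset.mem_univ, true_and,
          Equiv.Perm.inv_def, Equiv.apply_symm_apply]
        exact ⟨hlt, Nat.lt_succ_self _⟩
      · intro hmem
        have := (Finset.mem_filter.mp hmem).2.2
        simp only [Equiv.Perm.mul_apply, Equiv.Perm.inv_def, Equiv.apply_symm_apply,
          Equiv.swap_apply_left, Equiv.swap_apply_right] at this
        exact (Nat.lt_succ_self _).not_gt (Fin.lt_def.mp this)
  · intro h u hu
    rw [mem_youngSet_replicate_two] at hu
    refine Finset.card_le_card ?_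
    rintro ⟨x, y⟩ hxy
    simp only [Finset.mem_filter, Finset.mem_univ, true_and, Equiv.Perm.mul_apply,
      Fin.lt_def] at hxy ⊢
    refine ⟨hxy.1, ?_⟩
    have hblock : (d y : ℕ) / 2 ≠ d x / 2 := by
      intro heq
      have hlt := h ⟨d y / 2, by omega⟩
      have hy : blockFst ⟨d y / 2, by omega⟩ = d y := by
        simp only [blockFst, Fin.ext_iff]
        omega
      have hx : blockSnd ⟨d y / 2, by omega⟩ = d x := by
        simp only [blockSnd, Fin.ext_iff]
        omega
      rw [hx, hy, Equiv.Perm.inv_def, Equiv.symm_apply_apply,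
            Equiv.symm_apply_apply] at hlt
      exact absurd hxy.1 (by have := Fin.lt_def.mp hlt; omega)
    have := hu (d x)
    have := hu (d y)
    omega

theorem pimg_eq_blockFst {f i : ℕ} (d : Equiv.Perm (Fin (2 * f))) (hi : i < f) :
    pimg d (2 * i + 1) = d⁻¹ (blockFst ⟨i, hi⟩) + 1 := by
  rw [pimg, dif_pos (by omega)]
  rfl

theorem pimg_eq_blockSnd {f i : ℕ} (d : Equiv.Perm (Fin (2 * f))) (hi : i < f) :
    pimg d (2 * i + 2) = d⁻¹ (blockSnd ⟨i, hi⟩) + 1 := by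
  rw [pimg, dif_pos (by omega)]
  rfl

theorem mem_Hset_two_mul {f : ℕ} {d : Equiv.Perm (Fin (2 * f))} :
    d ∈ Hset (2 * f) f ↔ StrictMono (fun i : Fin f => d⁻¹ (blockFst i)) ∧
      ∀ i, d⁻¹ (blockFst i) < d⁻¹ (blockSnd i) := by
  simp only [Hset, Finset.mem_filter, Finset.mem_univ, true_and, Finset.mem_Icc]
  constructor
  · rintro ⟨h₁, h₂, -⟩
    constructor
    · rcases f with _ | n
      · exact fun i => i.elim0
      refine Fin.strictMono_iff_lt_succ.mpr fun i => ?_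
      have := h₁ (i + 1) ⟨by omega, by omega⟩
      rw [show 2 * ((i : ℕ) + 1) - 1 = 2 * i + 1 by omega, pimg_eq_blockFst d (by omega),
        pimg_eq_blockFst d (by omega)] at this
      exact Fin.lt_def.mpr (Nat.lt_of_add_lt_add_right this)
    · intro i
      have := h₂ (i + 1) ⟨by omega, by omega⟩
      rw [show 2 * ((i : ℕ) + 1) - 1 = 2 * i + 1 by omega, pimg_eq_blockFst d i.isLt,
        show 2 * ((i : ℕ) + 1) = 2 * i + 2 by omega, pimg_eq_blockSnd d i.isLt] at this
      exact Fin.lt_def.mpr (Nat.lt_of_add_lt_add_right this)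
  · rintro ⟨h₁, h₂⟩
    refine ⟨fun i hi => ?_, fun i hi => ?_, fun j hj => by omega⟩
    · obtain ⟨k, rfl⟩ := Nat.exists_eq_add_of_le' hi.1
      rw [show 2 * (k + 1) - 1 = 2 * k + 1 by omega, pimg_eq_blockFst d (by omega),
        pimg_eq_blockFst d (by omega)]
      exact Nat.add_lt_add_right (Fin.lt_def.mp (h₁ (Fin.mk_lt_mk.mpr k.lt_succ_self))) 1
    · obtain ⟨k, rfl⟩ := Nat.exists_eq_add_of_le' hi.1
      rw [show 2 * (k + 1) - 1 = 2 * k + 1 by omega, pimg_eq_blockFst d (by omega),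
        show 2 * (k + 1) = 2 * k + 2 by omega, pimg_eq_blockSnd d (by omega)]
      exact Nat.add_lt_add_right (Fin.lt_def.mp (h₂ _)) 1

theorem inv_blockHom_mul_blockFst {f : ℕ} (σ : Equiv.Perm (Fin f))
    (d : Equiv.Perm (Fin (2 * f))) (i : Fin f) :
    (blockHom f σ * d)⁻¹ (blockFst i) = d⁻¹ (blockFst (σ⁻¹ i)) := by
  rw [mul_inv_rev, Equiv.Perm.mul_apply, ← map_inv, blockHom_blockFst]

theorem inv_blockHom_mul_blockSnd {f : ℕ} (σ : Equiv.Perm (Fin f))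
    (d : Equiv.Perm (Fin (2 * f))) (i : Fin f) :
    (blockHom f σ * d)⁻¹ (blockSnd i) = d⁻¹ (blockSnd (σ⁻¹ i)) := by
  rw [mul_inv_rev, Equiv.Perm.mul_apply, ← map_inv, blockHom_blockSnd]

theorem blockHom_mul_mem_Dset {f : ℕ} (σ : Equiv.Perm (Fin f)) {d : Equiv.Perm (Fin (2 * f))}
    (hd : d ∈ Dset (2 * f) (List.replicate f 2)) :
    blockHom f σ * d ∈ Dset (2 * f) (List.replicate f 2) := by
  rw [mem_Dset_replicate_two] at hd ⊢
  intro i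
  rw [inv_blockHom_mul_blockFst, inv_blockHom_mul_blockSnd]
  exact hd _

theorem Hset_subset_Dset (f : ℕ) : Hset (2 * f) f ⊆ Dset (2 * f) (List.replicate f 2) :=
  fun _ hd => mem_Dset_replicate_two.mpr (mem_Hset_two_mul.mp hd).2

theorem exists_blockHom_mul_eq {f : ℕ} {d : Equiv.Perm (Fin (2 * f))}
    (hd : d ∈ Dset (2 * f) (List.replicate f 2)) :
    ∃ σ, ∃ h ∈ Hset (2 * f) f, blockHom f σ * h = d := by
  set g : Fin f → Fin (2 * f) := fun i => d⁻¹ (blockFst i)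
  refine ⟨Tuple.sort g, blockHom f (Tuple.sort g)⁻¹ * d, ?_, by rw [map_inv, mul_inv_cancel_left]⟩
  rw [mem_Hset_two_mul]
  refine ⟨?_, mem_Dset_replicate_two.mp (blockHom_mul_mem_Dset _ hd)⟩
  simp only [inv_blockHom_mul_blockFst, inv_inv]
  exact (Tuple.monotone_sort g).strictMono_of_injective
    ((d⁻¹.injective.comp blockFst_injective).comp (Tuple.sort g).injective)

theorem blockHom_mul_inj_of_mem_Hset {f : ℕ} {σ τ : Equiv.Perm (Fin f)}
    {h k : Equiv.Perm (Fin (2 * f))} (hh : h ∈ Hset (2 * f) f) (hk : k ∈ Hset (2 * f) f)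
    (heq : blockHom f σ * h = blockHom f τ * k) : σ = τ := by
  set g : Fin f → Fin (2 * f) := fun i => (blockHom f σ * h)⁻¹ (blockFst i) with hg
  have hσ : (fun i => h⁻¹ (blockFst i)) = g ∘ σ := by
    funext i
    simp [hg, inv_blockHom_mul_blockFst, -mul_inv_rev]
  have hτ : (fun i => k⁻¹ (blockFst i)) = g ∘ τ := by
    funext i
    simp [hg, heq, inv_blockHom_mul_blockFst, -mul_inv_rev]
  have hgσ := (mem_Hset_two_mul.mp hh).1
  have hgτ := (mem_Hset_two_mul.mp hk).1
  rw [hσ] at hgσ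
  rw [hτ] at hgτ
  have hrange : Set.range (g ∘ σ) = Set.range (g ∘ τ) := by
    rw [σ.surjective.range_comp, τ.surjective.range_comp]
  have hcomp := (hgσ.range_inj hgτ).mp hrange
  have hinj : Function.Injective g :=
    (blockHom f σ * h)⁻¹.injective.comp blockFst_injective
  ext1 i
  exact hinj (congrFun hcomp i)

/-- For `f ≥ 1`: the assignment (i-th adjacent transposition) `↦ 𝕤_i`
extends to an injective group homomorphism `S_f → S_{2f}` with image the subgroup
`𝕊_f = ⟨𝕤_1, …, 𝕤_{f-1}⟩`, and `D_{(2,…,2)} = 𝕊_f · H_f(2f)` with unique factorizations. -/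
theorem statement11 (f : ℕ) (hf : 1 ≤ f) :
    (∃ φ : Equiv.Perm (Fin f) →* Equiv.Perm (Fin (2 * f)),
      Function.Injective φ ∧
      (∀ i, 1 ≤ i → i ≤ f - 1 → φ (sGen f i) = bbs (2 * f) i) ∧
      MonoidHom.range φ =
        Subgroup.closure {w | ∃ i, 1 ≤ i ∧ i ≤ f - 1 ∧ w = bbs (2 * f) i}) ∧
    ((Dset (2 * f) (List.replicate f 2) : Set (Equiv.Perm (Fin (2 * f)))) =
      (Subgroup.closure {w | ∃ i, 1 ≤ i ∧ i ≤ f - 1 ∧ w = bbs (2 * f) i} :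
          Subgroup (Equiv.Perm (Fin (2 * f)))) *
        (Hset (2 * f) f : Set (Equiv.Perm (Fin (2 * f))))) ∧
    (∀ d ∈ Dset (2 * f) (List.replicate f 2),
      ∃! wd : Equiv.Perm (Fin (2 * f)) × Equiv.Perm (Fin (2 * f)),
        wd.1 ∈ Subgroup.closure {w | ∃ i, 1 ≤ i ∧ i ≤ f - 1 ∧ w = bbs (2 * f) i} ∧
        wd.2 ∈ Hset (2 * f) f ∧ d = wd.1 * wd.2) := by
  rw [← range_blockHom]
  refine ⟨⟨blockHom f, blockHom_injective f, fun i => blockHom_sGen, rfl⟩, ?_, fun d hd => ?_⟩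
  · ext d
    simp only [Set.mem_mul, SetLike.mem_coe]
    constructor
    · intro hd
      obtain ⟨σ, h, hh, rfl⟩ := exists_blockHom_mul_eq hd
      exact ⟨_, ⟨σ, rfl⟩, h, hh, rfl⟩
    · rintro ⟨_, ⟨σ, rfl⟩, h, hh, rfl⟩
      exact blockHom_mul_mem_Dset σ (Hset_subset_Dset f hh)
  · obtain ⟨σ, h, hh, rfl⟩ := exists_blockHom_mul_eq hd
    refine ⟨(blockHom f σ, h), ⟨⟨σ, rfl⟩, hh, rfl⟩, ?_⟩
    rintro ⟨_, k⟩ ⟨⟨τ, rfl⟩, hk, heq⟩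
    obtain rfl := blockHom_mul_inj_of_mem_Hset hh hk heq
    rw [mul_left_cancel heq]

end BMWPaper
end
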